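/- Let G = (V, E) be a finite connected simple graph and τ : V → ℕ a threshold function with τ(v) ≤ d_G(v) for every v ∈ V, and let G' and x be the multigraph and divisor of the standard construction. Then ts_G(τ) ≤ dist_rec_{G'}(x). -/

import Mathlib

variable {V : Type*} [Fintype V] [DecidableEq V]

/-- The degree of vertex `v` in the multigraph with edge-multiplicity function `m`. -/
def mgDeg (m : V → V → ℕ) (v : V) : ℕ := ∑ u, m v u

/-- The divisor obtained from `f` by firing vertex `v`. -/
def mgFire (m : V → V → ℕ) (f : V → ℤ) (v : V) : V → ℤ :=
  fun u => if u = v then f v - mgDeg m v else f u + m v u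

/-- The divisor obtained from `f` by firing the vertices of `L` in order. -/
def mgPlay (m : V → V → ℕ) (f : V → ℤ) (L : List V) : V → ℤ :=
  L.foldl (mgFire m) f

/-- `L` is a legal game from `f`: each fired vertex is active when fired. -/
def mgLegal (m : V → V → ℕ) : (V → ℤ) → List V → Prop
  | _, [] => True
  | f, v :: L => ((mgDeg m v : ℤ) ≤ f v) ∧ mgLegal m (mgFire m f v) L

/-- A divisor is stable if no vertex is active. -/
def mgStable (m : V → V → ℕ) (f : V → ℤ) : Prop := ∀ v, f v < (mgDeg m v : ℤ)

/-- A divisor is halting if some legal game from it ends at a stable divisor. -/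
def mgHalting (m : V → V → ℕ) (f : V → ℤ) : Prop :=
  ∃ L : List V, mgLegal m f L ∧ mgStable m (mgPlay m f L)

/-- A divisor is recurrent if some non-empty legal game from it leads back to it. -/
def mgRecurrent (m : V → V → ℕ) (f : V → ℤ) : Prop :=
  ∃ L : List V, L ≠ [] ∧ mgLegal m f L ∧ mgPlay m f L = f

/-- A divisor is effective if it is nonnegative everywhere. -/
def mgEffective (f : V → ℤ) : Prop := ∀ v, 0 ≤ f v

/-- The degree of a divisor. -/
def mgDegDiv (f : V → ℤ) : ℤ := ∑ v, f v

/-- Distance of a divisor from a recurrent state. -/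
noncomputable def mgDistRec (m : V → V → ℕ) (f : V → ℤ) : ℕ :=
  sInf {n : ℕ | ∃ g : V → ℤ, mgEffective g ∧ mgDegDiv g = (n : ℤ) ∧ mgRecurrent m (f + g)}

/-- Distance of a divisor from a non-halting state. -/
noncomputable def mgDistNonhalt (m : V → V → ℕ) (f : V → ℤ) : ℕ :=
  sInf {n : ℕ | ∃ g : V → ℤ, mgEffective g ∧ mgDegDiv g = (n : ℤ) ∧ ¬ mgHalting m (f + g)}

/-- A multigraph is connected if any two vertices are joined by a path of
positive-multiplicity edges. -/
def mgConnected (m : V → V → ℕ) : Prop :=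
  ∀ u v : V, Relation.ReflTransGen (fun a b => 0 < m a b) u v

/-- `f` and `g` are linearly equivalent: `f` can be transformed to `g` by firings. -/
def mgLinEquiv (m : V → V → ℕ) (f g : V → ℤ) : Prop :=
  ∃ L : List V, mgPlay m f L = g

/-- A divisor is winnable if it is linearly equivalent to an effective divisor. -/
def mgWinnable (m : V → V → ℕ) (f : V → ℤ) : Prop :=
  ∃ g : V → ℤ, mgEffective g ∧ mgLinEquiv m f g

/-- The rank of a divisor. -/
noncomputable def mgRank (m : V → V → ℕ) (f : V → ℤ) : ℤ :=
  ((sInf {n : ℕ | ∃ g : V → ℤ, mgEffective g ∧ mgDegDiv g = (n : ℤ) ∧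
    ¬ mgWinnable m (f - g)} : ℕ) : ℤ) - 1

/-- One round of the activation process: every vertex with at least `τ v`
active neighbors becomes active (and active vertices stay active). -/
def tssStep (G : SimpleGraph V) [DecidableRel G.Adj] (τ : V → ℕ) (A : Finset V) : Finset V :=
  A ∪ Finset.univ.filter (fun v => τ v ≤ (A.filter (fun u => G.Adj v u)).card)

/-- `S` is a target set: the activation process starting from `S` eventually
activates all vertices. -/
def tssIsTargetSet (G : SimpleGraph V) [DecidableRel G.Adj] (τ : V → ℕ) (S : Finset V) : Prop :=
  ∃ n : ℕ, (tssStep G τ)^[n] S = Finset.univ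

/-- Minimum cardinality of a target set. -/
noncomputable def tssMin (G : SimpleGraph V) [DecidableRel G.Adj] (τ : V → ℕ) : ℕ :=
  sInf {k : ℕ | ∃ S : Finset V, tssIsTargetSet G τ S ∧ S.card = k}

/-- Auxiliary (one-directional) edge multiplicities of the standard construction.
In the vertex type `(V ⊕ V ⊕ V) ⊕ G.Dart`, the first, second and third summands
of `V ⊕ V ⊕ V` encode `v_i`, `v_c`, `v_o` respectively, and a dart `d = (u, v)`
encodes the vertex `p_{uv}`. -/
def consAux (G : SimpleGraph V) [DecidableRel G.Adj] (N : ℕ) :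
    (V ⊕ V ⊕ V) ⊕ G.Dart → (V ⊕ V ⊕ V) ⊕ G.Dart → ℕ
  | Sum.inl (Sum.inl v), Sum.inl (Sum.inr (Sum.inl w)) => if v = w then N else 0
  | Sum.inl (Sum.inr (Sum.inl v)), Sum.inl (Sum.inr (Sum.inr w)) => if v = w then 1 else 0
  | Sum.inl (Sum.inr (Sum.inr v)), Sum.inr d => if d.toProd.1 = v then N else 0
  | Sum.inr d, Sum.inl (Sum.inl v) => if d.toProd.2 = v then 1 else 0
  | _, _ => 0

/-- Edge-multiplicity function of the multigraph `G'` of the standard construction: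
`N` parallel edges between `v_i` and `v_c`, one edge between `v_c` and `v_o`, and,
for each edge `uv` of `G`, `N` parallel edges between `u_o` and `p_{uv}` and one
edge between `p_{uv}` and `v_i`. -/
def consM (G : SimpleGraph V) [DecidableRel G.Adj] (N : ℕ)
    (a b : (V ⊕ V ⊕ V) ⊕ G.Dart) : ℕ :=
  consAux G N a b + consAux G N b a

/-- The divisor `x` of the standard construction: `x(v_i) = d_G(v) + N - τ(v)`,
`x(v_c) = 1`, `x(v_o) = N * d_G(v)`, and `x(p) = 1` for every vertex `p_{uv}`. -/
def consX (G : SimpleGraph V) [DecidableRel G.Adj] (τ : V → ℕ) (N : ℕ) :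
    (V ⊕ V ⊕ V) ⊕ G.Dart → ℤ
  | Sum.inl (Sum.inl v) => (G.degree v : ℤ) + N - τ v
  | Sum.inl (Sum.inr (Sum.inl _)) => 1
  | Sum.inl (Sum.inr (Sum.inr v)) => (N : ℤ) * G.degree v
  | Sum.inr _ => 1

theorem play_append {W : Type*} [Fintype W] [DecidableEq W] (m : W → W → ℕ) (f : W → ℤ) (L : List W) (w : W) :
    mgPlay m f (L ++ [w]) = mgFire m (mgPlay m f L) w := by
  simp [mgPlay]

theorem legal_append {W : Type*} [Fintype W] [DecidableEq W] (m : W → W → ℕ) (L : List W) (w : W) :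
    ∀ f : W → ℤ, mgLegal m f (L ++ [w]) ↔
      mgLegal m f L ∧ (mgDeg m w : ℤ) ≤ mgPlay m f L w := by
  induction L with
  | nil => intro f; simp [mgLegal, mgPlay]
  | cons a L ih =>
    intro f
    simp only [List.cons_append, mgLegal, ih, mgPlay, List.foldl_cons, and_assoc]

/-- Vertices ordered by last firing: bound on final chips. -/
theorem last_bound {W : Type*} [Fintype W] [DecidableEq W] (m : W → W → ℕ) (f : W → ℤ) (L : List W) :
    mgLegal m f L → ∀ v ∈ L,
      (∑ u, if L.reverse.idxOf u < L.reverse.idxOf v then (m u v : ℤ) else 0) ≤ mgPlay m f L v := by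
  induction L using List.reverseRecOn with
  | nil => simp
  | append_singleton L w ih =>
    intro hl v hv
    rw [legal_append] at hl
    rw [play_append]
    simp only [List.reverse_append, List.reverse_cons, List.reverse_nil, List.nil_append,
      List.singleton_append, List.idxOf_cons]
    by_cases h : v = w
    · subst h
      simp [mgFire]
      exact hl.2
    · have hv' : v ∈ L := by simpa [h] using hv
      have := ih hl.1 v hv'
      have h2 : ∀ u, (if (if w == u then 0 else L.reverse.idxOf u + 1) < (if w == v then 0 else L.reverse.idxOf v + 1) then (m u v : ℤ) else 0) ≤ (if L.reverse.idxOf u < L.reverse.idxOf v then (m u v : ℤ) else 0) + if u = w then (m w v : ℤ) else 0 := by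
        intro u
        have hw : (w == v) = false := by simpa using fun e => h e.symm
        by_cases hu : u = w
        · subst hu
          simp [hw]
          split_ifs <;> simp
        · have hw' : (w == u) = false := by simpa using fun e => hu e.symm
          simp [hw, hw', hu]
      refine (Finset.sum_le_sum (g := fun u => (if L.reverse.idxOf u < L.reverse.idxOf v then (m u v : ℤ) else 0) + if u = w then (m w v : ℤ) else 0) (fun u _ => ?_)).trans ?_
      · simpa only [Bool.cond_eq_ite] using h2 u
      · rw [Finset.sum_add_distrib]
        simp [mgFire, h]
        exact this

theorem exists_rank {W : Type*} [Fintype W] [DecidableEq W] (m : W → W → ℕ) (f : W → ℤ) (L : List W)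
    (hl : mgLegal m f L) (hall : ∀ v, v ∈ L) : ∃ r : W → ℕ, (∀ u v, r u = r v → u = v) ∧
      ∀ v, (∑ u, if r u < r v then (m u v : ℤ) else 0) ≤ mgPlay m f L v :=
  ⟨fun u => L.reverse.idxOf u, fun u _ h => (List.idxOf_inj (by simpa using hall u)).1 h,
    fun v => last_bound m f L hl v (hall v)⟩

theorem play_notMem {W : Type*} [Fintype W] [DecidableEq W] (m : W → W → ℕ) (f : W → ℤ) (L : List W)
    (v : W) (hv : v ∉ L) :
    f v ≤ mgPlay m f L v ∧ ∀ u ∈ L, f v + m u v ≤ mgPlay m f L v := by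
  induction L using List.reverseRecOn with
  | nil => simp [mgPlay]
  | append_singleton L w ih =>
    simp only [List.mem_append, List.mem_singleton, not_or] at hv
    obtain ⟨h1, h2⟩ := ih hv.1
    rw [play_append]
    simp only [mgFire, hv.2, if_false]
    refine ⟨by omega, ?_⟩
    intro u hu
    simp only [List.mem_append, List.mem_singleton] at hu
    rcases hu with hu | rfl
    · have := h2 u hu
      omega
    · omega

theorem exists_recurrent {W : Type*} [Fintype W] [DecidableEq W] [Nonempty W] (m : W → W → ℕ)
    (hm : ∀ v, m v v = 0) (hs : ∀ u v, m u v = m v u) (f : W → ℤ) (hf : ∀ v, (mgDeg m v : ℤ) ≤ f v) :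
    mgRecurrent m f := by
  have key : ∀ L : List W, L.Nodup → mgLegal m f L ∧ ∀ v,
      mgPlay m f L v = f v + (L.map (fun u => (m u v : ℤ))).sum - if v ∈ L then (mgDeg m v : ℤ) else 0 := by
    intro L
    induction L using List.reverseRecOn with
    | nil => simp [mgLegal, mgPlay]
    | append_singleton L w ih =>
      intro hn
      have hn' : L.Nodup ∧ w ∉ L := by
        rw [List.nodup_append] at hn
        refine ⟨hn.1, fun h => ?_⟩
        exact hn.2.2 w h w (by simp) rfl
      obtain ⟨h1, h2⟩ := ih hn'.1
      rw [legal_append]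
      refine ⟨⟨h1, ?_⟩, ?_⟩
      · have h0 : 0 ≤ (L.map (fun u => (m u w : ℤ))).sum := by
          apply List.sum_nonneg
          intro x hx
          obtain ⟨u, _, rfl⟩ := List.mem_map.1 hx
          positivity
        rw [h2, if_neg hn'.2]
        have := hf w
        omega
      · intro v
        rw [play_append]
        by_cases h : v = w
        · subst h
          simp [mgFire, h2, hn'.2, hm]
        · simp [mgFire, h2, h]
          ring
  obtain ⟨h1, h2⟩ := key Finset.univ.toList (Finset.nodup_toList _)
  refine ⟨_, ?_, h1, ?_⟩
  · simp [Finset.univ_eq_empty_iff]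
  · funext v
    rw [h2]
    simp [mgDeg, hs v]

theorem all_fired [Nonempty V] (G : SimpleGraph V) [DecidableRel G.Adj]
    (hconn : G.Connected) (N : ℕ) (hN : 0 < N) (L : List ((V ⊕ V ⊕ V) ⊕ G.Dart)) (hL : L ≠ [])
    (hcl : ∀ u v, u ∈ L → 0 < consM G N u v → v ∈ L) : ∀ v, v ∈ L := by
  have ic : ∀ v : V, Sum.inl (Sum.inl v) ∈ L → Sum.inl (Sum.inr (Sum.inl v)) ∈ L :=
    fun v h => hcl _ _ h (by simp [consM, consAux, hN])
  have ci : ∀ v : V, Sum.inl (Sum.inr (Sum.inl v)) ∈ L → Sum.inl (Sum.inl v) ∈ L :=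
    fun v h => hcl _ _ h (by simp [consM, consAux, hN])
  have co : ∀ v : V, Sum.inl (Sum.inr (Sum.inl v)) ∈ L → Sum.inl (Sum.inr (Sum.inr v)) ∈ L :=
    fun v h => hcl _ _ h (by simp [consM, consAux])
  have oc : ∀ v : V, Sum.inl (Sum.inr (Sum.inr v)) ∈ L → Sum.inl (Sum.inr (Sum.inl v)) ∈ L :=
    fun v h => hcl _ _ h (by simp [consM, consAux])
  have po : ∀ d : G.Dart, Sum.inr d ∈ L → Sum.inl (Sum.inr (Sum.inr d.toProd.1)) ∈ L :=
    fun v h => hcl _ _ h (by simp [consM, consAux, hN])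
  have op : ∀ d : G.Dart, Sum.inl (Sum.inr (Sum.inr d.toProd.1)) ∈ L → Sum.inr d ∈ L :=
    fun v h => hcl _ _ h (by simp [consM, consAux, hN])
  have pi : ∀ d : G.Dart, Sum.inr d ∈ L → Sum.inl (Sum.inl d.toProd.2) ∈ L :=
    fun v h => hcl _ _ h (by simp [consM, consAux])
  obtain ⟨w, hw⟩ := List.exists_mem_of_ne_nil L hL
  obtain ⟨a, ha⟩ : ∃ a : V, Sum.inl (Sum.inr (Sum.inr a)) ∈ L := by
    rcases w with (v | v | v) | d
    · exact ⟨v, co _ (ic _ hw)⟩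
    · exact ⟨v, co _ hw⟩
    · exact ⟨v, hw⟩
    · exact ⟨_, po _ hw⟩
  have ho : ∀ v : V, Sum.inl (Sum.inr (Sum.inr v)) ∈ L := by
    intro v
    obtain ⟨p⟩ := hconn.preconnected a v
    induction p with
    | nil => exact ha
    | cons h p ih =>
      apply ih
      exact co _ (ic _ (pi ⟨(_, _), h⟩ (op ⟨(_, _), h⟩ ha)))
  rintro ((v | v | v) | d)
  · exact ci _ (oc _ (ho v))
  · exact oc _ (ho v)
  · exact ho v
  · exact op _ (ho _)

theorem dart_snd_card (G : SimpleGraph V) [DecidableRel G.Adj] (v : V) :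
    (Finset.univ.filter (fun d : G.Dart => d.toProd.2 = v)).card = G.degree v := by
  rw [← G.dart_fst_fiber_card_eq_degree v]
  apply Finset.card_bij (fun d _ => d.symm)
  · intro d hd
    simpa using hd
  · intro a _ b _ h
    exact SimpleGraph.Dart.symm_involutive.injective h
  · intro b hb
    exact ⟨b.symm, by simpa using hb, by simp⟩

theorem main_aux [Nonempty V] (G : SimpleGraph V) [DecidableRel G.Adj]
    (hconn : G.Connected) (τ : V → ℕ) (n : ℕ)
    (g : (V ⊕ V ⊕ V) ⊕ G.Dart → ℤ) (hg : mgEffective g) (hd : mgDegDiv g = n)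
    (hr : mgRecurrent (consM G (Fintype.card V + 2)) (consX G τ (Fintype.card V + 2) + g)) :
    ∃ S : Finset V, tssIsTargetSet G τ S ∧ S.card ≤ n := by
  by_cases hn : Fintype.card V ≤ n
  · exact ⟨Finset.univ, ⟨0, rfl⟩, by simpa using hn⟩
  have hgn : ∀ v, g v ≤ n := by
    intro v
    rw [← hd]
    exact Finset.single_le_sum (fun i _ => hg i) (Finset.mem_univ v)
  set N := Fintype.card V + 2 with hNdef
  obtain ⟨L, hL, hleg, hplay⟩ := hr
  have hall : ∀ v, v ∈ L := by
    refine all_fired G hconn N (by omega) L hL ?_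
    intro u v hu hm
    by_contra hv
    have := (play_notMem (consM G N) (consX G τ N + g) L v hv).2 u hu
    rw [hplay] at this
    omega
  obtain ⟨r, hinj, hbound⟩ := exists_rank _ _ L hleg hall
  rw [hplay] at hbound
  simp only [Pi.add_apply] at hbound
  have single : ∀ u v, r u < r v → (consM G N u v : ℤ) ≤ consX G τ N v + g v := by
    intro u v h
    refine le_trans ?_ (hbound v)
    have := Finset.single_le_sum (f := fun u => if r u < r v then (consM G N u v : ℤ) else 0)
      (fun i _ => by split_ifs <;> positivity) (Finset.mem_univ u)
    simpa [h] using this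
  have hci : ∀ v : V, r (.inl (.inr (.inl v))) < r (.inl (.inl v)) := by
    intro v
    by_contra h
    have hne : r (.inl (.inl v)) ≠ r (.inl (.inr (.inl v))) := fun e => by simpa using hinj _ _ e
    have := single (.inl (.inl v)) (.inl (.inr (.inl v))) (by omega)
    simp [consM, consAux, consX] at this
    have := hgn (.inl (.inr (.inl v)))
    omega
  have hpo : ∀ d : G.Dart, r (.inr d) < r (.inl (.inr (.inr d.toProd.1))) := by
    intro d
    by_contra h
    have hne : r (.inr d) ≠ r (.inl (.inr (.inr d.toProd.1))) := fun e => by simpa using hinj _ _ e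
    have := single (.inl (.inr (.inr d.toProd.1))) (.inr d) (by omega)
    simp [consM, consAux, consX] at this
    have := hgn (.inr d)
    omega
  have hoc : ∀ v : V, g (.inl (.inr (.inr v))) = 0 →
      r (.inl (.inr (.inr v))) ≤ r (.inl (.inr (.inl v))) := by
    intro v h0
    by_contra h
    have := hbound (.inl (.inr (.inr v)))
    simp only [Fintype.sum_sum_type, h0, consX, add_zero] at this
    have e1 : ∀ d : G.Dart, (if r (.inr d) < r (.inl (.inr (.inr v))) then
        (consM G N (.inr d) (.inl (.inr (.inr v))) : ℤ) else 0) = if d.toProd.1 = v then (N:ℤ) else 0 := by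
      intro d
      by_cases hv : d.toProd.1 = v
      · subst hv
        simp [hpo d, consM, consAux]
      · simp [hv, consM, consAux]
    have e2 : ∀ u : V, (if r (.inl (.inr (.inl u))) < r (.inl (.inr (.inr v))) then
        (consM G N (.inl (.inr (.inl u))) (.inl (.inr (.inr v))) : ℤ) else 0) = if u = v then 1 else 0 := by
      intro u
      by_cases hv : u = v
      · subst hv
        simp [consM, consAux]
        omega
      · simp [hv, consM, consAux]
    rw [Finset.sum_congr rfl (fun d _ => e1 d), Finset.sum_congr rfl (fun d _ => e2 d),
      ← Finset.sum_filter (fun d : G.Dart => d.toProd.1 = v), Finset.sum_const,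
      G.dart_fst_fiber_card_eq_degree v] at this
    simp [consM, consAux, mul_comm] at this
  have hi : ∀ v : V, g (.inl (.inl v)) = 0 →
      τ v ≤ (Finset.univ.filter (fun d : G.Dart => d.toProd.2 = v ∧ ¬ r (.inr d) < r (.inl (.inl v)))).card := by
    intro v h0
    have := hbound (.inl (.inl v))
    simp only [Fintype.sum_sum_type, h0, consX, add_zero] at this
    have e1 : ∀ d : G.Dart, (if r (.inr d) < r (.inl (.inl v)) then
        (consM G N (.inr d) (.inl (.inl v)) : ℤ) else 0) =
        if d.toProd.2 = v ∧ r (.inr d) < r (.inl (.inl v)) then (1:ℤ) else 0 := by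
      intro d
      by_cases hv : d.toProd.2 = v
      · subst hv
        simp [consM, consAux]
      · simp [hv, consM, consAux]
    have e2 : ∀ u : V, (if r (.inl (.inr (.inl u))) < r (.inl (.inl v)) then
        (consM G N (.inl (.inr (.inl u))) (.inl (.inl v)) : ℤ) else 0) = if u = v then (N:ℤ) else 0 := by
      intro u
      by_cases hv : u = v
      · subst hv
        simp [consM, consAux, hci]
      · simp [hv, Ne.symm hv, consM, consAux]
    rw [Finset.sum_congr rfl (fun d _ => e1 d), Finset.sum_congr rfl (fun d _ => e2 d),
      ← Finset.sum_filter (fun d : G.Dart => d.toProd.2 = v ∧ r (.inr d) < r (.inl (.inl v))),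
      Finset.sum_const] at this
    have hsplit := Finset.card_filter_add_card_filter_not
      (s := Finset.univ.filter (fun d : G.Dart => d.toProd.2 = v)) (fun d => r (.inr d) < r (.inl (.inl v)))
    rw [dart_snd_card, Finset.filter_filter, Finset.filter_filter] at hsplit
    simp [consM, consAux] at this
    simp only [not_lt] at hsplit ⊢
    omega
  set S : Finset V := Finset.univ.filter
    (fun v => g (.inl (.inl v)) ≠ 0 ∨ g (.inl (.inr (.inr v))) ≠ 0) with hS
  have hmono : ∀ k, (tssStep G τ)^[k] S ⊆ (tssStep G τ)^[k+1] S := by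
    intro k
    rw [Function.iterate_succ_apply']
    exact Finset.subset_union_left
  have hSk : ∀ k, S ⊆ (tssStep G τ)^[k] S := by
    intro k
    induction k with
    | zero => exact subset_rfl
    | succ k ih => exact ih.trans (hmono k)
  obtain ⟨M, hM⟩ : ∃ M, ∀ v : V, r (.inl (.inr (.inr v))) < M := by
    refine ⟨Finset.univ.sup (fun v : V => r (.inl (.inr (.inr v)))) + 1, fun v => ?_⟩
    exact Nat.lt_succ_of_le (Finset.le_sup (f := fun v : V => r (.inl (.inr (.inr v)))) (Finset.mem_univ v))
  have hact : ∀ k, ∀ v : V, M ≤ r (.inl (.inr (.inr v))) + k → v ∈ (tssStep G τ)^[k] S := by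
    intro k
    induction k with
    | zero => intro v h; have := hM v; omega
    | succ k ih =>
      intro v h
      by_cases hv : v ∈ S
      · exact hSk _ hv
      have hv' : g (.inl (.inl v)) = 0 ∧ g (.inl (.inr (.inr v))) = 0 := by
        simpa [hS] using hv
      rw [Function.iterate_succ_apply']
      refine Finset.mem_union_right _ ?_
      simp only [Finset.mem_filter, Finset.mem_univ, true_and]
      refine (hi v hv'.1).trans ?_
      apply Finset.card_le_card_of_injOn (fun d => d.toProd.1)
      · intro d hd
        simp only [Finset.coe_filter, Finset.mem_univ, true_and, Set.mem_setOf_eq] at hd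
        obtain ⟨rfl, hd⟩ := hd
        simp only [Finset.coe_filter, Set.mem_setOf_eq]
        refine ⟨ih _ ?_, d.adj.symm⟩
        have h1 := hpo d
        have h2 := hci d.toProd.2
        have h3 := hoc d.toProd.2 hv'.2
        omega
      · intro a ha b hb hab
        simp only [Finset.coe_filter, Finset.mem_univ, true_and, Set.mem_setOf_eq] at ha hb
        apply SimpleGraph.Dart.ext
        exact Prod.ext hab (ha.1.trans hb.1.symm)
  refine ⟨S, ⟨M, ?_⟩, ?_⟩
  · rw [Finset.eq_univ_iff_forall]
    exact fun v => hact M v (by omega)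
  · have h1 : (S.card : ℤ) ≤ ∑ v : V, (g (.inl (.inl v)) + g (.inl (.inr (.inr v)))) := by
      rw [hS, Finset.card_filter]
      push_cast
      apply Finset.sum_le_sum
      intro v _
      have a := hg (.inl (.inl v))
      have b := hg (.inl (.inr (.inr v)))
      split_ifs <;> omega
    have h2 : ∑ v : V, (g (.inl (.inl v)) + g (.inl (.inr (.inr v)))) ≤ mgDegDiv g := by
      simp only [mgDegDiv, Fintype.sum_sum_type, Finset.sum_add_distrib]
      have a : 0 ≤ ∑ v : V, g (.inl (.inr (.inl v))) := Finset.sum_nonneg (fun i _ => hg _)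
      have b : 0 ≤ ∑ v : G.Dart, g (.inr v) := Finset.sum_nonneg (fun i _ => hg _)
      linarith
    omega

/-- `ts_G(τ) ≤ dist_rec_{G'}(x)` for the standard construction (on a connected
simple graph `G`) with `N = |V| + 2`. -/
theorem stmt10 [Nonempty V] (G : SimpleGraph V) [DecidableRel G.Adj]
    (hconn : G.Connected) (τ : V → ℕ) (hτ : ∀ v, τ v ≤ G.degree v) :
    tssMin G τ ≤
      mgDistRec (consM G (Fintype.card V + 2)) (consX G τ (Fintype.card V + 2)) := by
  have hne : {n : ℕ | ∃ g : (V ⊕ V ⊕ V) ⊕ G.Dart → ℤ, mgEffective g ∧ mgDegDiv g = (n : ℤ) ∧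
      mgRecurrent (consM G (Fintype.card V + 2)) (consX G τ (Fintype.card V + 2) + g)}.Nonempty := by
    set m := consM G (Fintype.card V + 2)
    set x := consX G τ (Fintype.card V + 2)
    let g : (V ⊕ V ⊕ V) ⊕ G.Dart → ℤ := fun v => (mgDeg m v : ℤ) + |x v|
    have hg : mgEffective g := fun v => by positivity
    refine ⟨(mgDegDiv g).toNat, g, hg, ?_, ?_⟩
    · rw [Int.toNat_of_nonneg]
      exact Finset.sum_nonneg (fun i _ => hg i)
    · apply exists_recurrent
      · rintro ((v | v | v) | d) <;> simp [m, consM, consAux]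
      · intro u v
        exact Nat.add_comm _ _
      · intro v
        have := neg_abs_le (x v)
        simp only [Pi.add_apply, g]
        linarith
  obtain ⟨g, hg, hd, hr⟩ := Nat.sInf_mem hne
  obtain ⟨S, hS, hc⟩ := main_aux G hconn τ _ g hg hd hr
  have h1 : tssMin G τ ≤ S.card := Nat.sInf_le ⟨S, hS, rfl⟩
  exact h1.trans hc
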